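/- Let u : R → U be a flat injective ring epimorphism of commutative rings, K := U/R, and G the associated Gabriel topology. Then: (i) Hom_R(K, M) is a u-contramodule for every R-module M, i.e. Hom_R(U, Hom_R(K, M)) = 0 and Ext^1_R(U, Hom_R(K, M)) = 0; (ii) Δ_u(N) := Ext^1_R(K, N) is a u-contramodule for every G-torsion-free R-module N. -/

import Mathlib

universe u

/-- A Gabriel topology on a commutative ring `R`: a filter of ideals of `R`
satisfying the Gabriel axiom T4. -/
structure GabrielTopology (R : Type u) [CommRing R] : Type u where
  sets : Set (Ideal R)
  top_mem : (⊤ : Ideal R) ∈ sets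
  mem_of_le : ∀ {I J : Ideal R}, I ∈ sets → I ≤ J → J ∈ sets
  inf_mem : ∀ {I J : Ideal R}, I ∈ sets → J ∈ sets → I ⊓ J ∈ sets
  gabriel : ∀ I J : Ideal R, J ∈ sets →
    (∀ r ∈ J, Submodule.colon I (Ideal.span {r}) ∈ sets) → I ∈ sets

namespace GabrielTopology

variable {R : Type u} [CommRing R] (G : GabrielTopology R)

/-- A module `M` is `G`-torsion if the annihilator of every element belongs to `G`. -/
def IsTorsion (M : Type u) [AddCommGroup M] [Module R M] : Prop :=
  ∀ x : M, Ideal.torsionOf R M x ∈ G.sets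

/-- A module `M` is `G`-torsion-free if no nonzero element is annihilated by an ideal of `G`. -/
def IsTorsionFree (M : Type u) [AddCommGroup M] [Module R M] : Prop :=
  ∀ x : M, Ideal.torsionOf R M x ∈ G.sets → x = 0

/-- A module `M` is `G`-divisible if `JM = M` for every `J ∈ G`. -/
def IsDivisible (M : Type u) [AddCommGroup M] [Module R M] : Prop :=
  ∀ J ∈ G.sets, J • (⊤ : Submodule R M) = ⊤

/-- `G` is faithful if `R` is `G`-torsion-free. -/
def Faithful : Prop := ∀ r : R, Ideal.torsionOf R R r ∈ G.sets → r = 0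

/-- `G` is finitely generated if it has a basis of finitely generated ideals. -/
def FinitelyGenerated : Prop := ∀ J ∈ G.sets, ∃ J' ∈ G.sets, J' ≤ J ∧ J'.FG

end GabrielTopology

/-- `Ext¹_R(M, N) = 0`, expressed by the standard characterisation:
every short exact sequence `0 → N → E → M → 0` splits. -/
def Ext1Vanish (R : Type u) [CommRing R] (M N : Type u) [AddCommGroup M] [Module R M]
    [AddCommGroup N] [Module R N] : Prop :=
  ∀ (E : Type u) [AddCommGroup E] [Module R E] (i : N →ₗ[R] E) (p : E →ₗ[R] M),
    Function.Injective i → Function.Surjective p → LinearMap.range i = LinearMap.ker p →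
      ∃ s : M →ₗ[R] E, p ∘ₗ s = LinearMap.id

/-- `M` has projective dimension at most 1: the kernel of a free cover is projective. -/
def ProjDimLE1 (R : Type u) [CommRing R] (M : Type u) [AddCommGroup M] [Module R M] : Prop :=
  ∃ (ι : Type u) (p : (ι →₀ R) →ₗ[R] M),
    Function.Surjective p ∧ Module.Projective R ↥(LinearMap.ker p)

/-- `M ∈ Add(T)`: `M` is a direct summand of a direct sum of copies of `T`. -/
def InAdd (R : Type u) [CommRing R] (T M : Type u) [AddCommGroup T] [Module R T]
    [AddCommGroup M] [Module R M] : Prop :=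
  ∃ (ι : Type u) (s : M →ₗ[R] (ι →₀ T)) (r : (ι →₀ T) →ₗ[R] M), r ∘ₗ s = LinearMap.id

/-- `T` is a 1-tilting module: (T1) `p.dim T ≤ 1`, (T2) `Ext¹(T, T^(κ)) = 0` for all κ,
(T3) there is an exact sequence `0 → R → T₀ → T₁ → 0` with `T₀, T₁ ∈ Add(T)`. -/
def Is1Tilting (R : Type u) [CommRing R] (T : Type u) [AddCommGroup T] [Module R T] : Prop :=
  ProjDimLE1 R T ∧
  (∀ ι : Type u, Ext1Vanish R T (ι →₀ T)) ∧
  ∃ (T0 T1 : ModuleCat.{u} R) (i : R →ₗ[R] ↥T0) (p : ↥T0 →ₗ[R] ↥T1),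
    InAdd R T ↥T0 ∧ InAdd R T ↥T1 ∧
    Function.Injective i ∧ Function.Surjective p ∧ LinearMap.range i = LinearMap.ker p

namespace GabrielTopology

variable {R : Type u} [CommRing R] (G : GabrielTopology R)

/-- `(𝒜, 𝒟_G)` is a 1-tilting cotorsion pair with associated Gabriel topology `G`:
`G` is a faithful finitely generated Gabriel topology and the class of `G`-divisible
modules is the tilting class of a 1-tilting module. -/
def IsTiltingTopology : Prop :=
  G.Faithful ∧ G.FinitelyGenerated ∧
  ∃ T : ModuleCat.{u} R, Is1Tilting R ↥T ∧
    ∀ (M : Type u) [AddCommGroup M] [Module R M], (Ext1Vanish R ↥T M ↔ G.IsDivisible M)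

/-- Membership in the left-hand class `𝒜 = ᗮ(𝒟_G)` of the 1-tilting cotorsion pair. -/
def MemA (M : Type u) [AddCommGroup M] [Module R M] : Prop :=
  ∀ (D : Type u) [AddCommGroup D] [Module R D], G.IsDivisible D → Ext1Vanish R M D

/-- The class `𝒜` is covering: every module has an `𝒜`-cover. -/
def IsACovering : Prop :=
  ∀ (M : Type u) [AddCommGroup M] [Module R M],
    ∃ (C : ModuleCat.{u} R) (φ : ↥C →ₗ[R] M),
      G.MemA ↥C ∧
      (∀ (C' : Type u) [AddCommGroup C'] [Module R C'], G.MemA C' →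
        ∀ f : C' →ₗ[R] M, ∃ g : C' →ₗ[R] ↥C, φ ∘ₗ g = f) ∧
      (∀ e : ↥C →ₗ[R] ↥C, φ ∘ₗ e = φ → Function.Bijective e)

/-- The class `𝒜` is closed under direct limits. -/
def AClosedUnderDirectLimits : Prop :=
  ∀ (ι : Type u) [Preorder ι] [IsDirected ι (· ≤ ·)] [Nonempty ι] [DecidableEq ι]
    (M : ι → Type u) [∀ i, AddCommGroup (M i)] [∀ i, Module R (M i)]
    (f : ∀ i j, i ≤ j → M i →ₗ[R] M j) [DirectedSystem M fun i j h => f i j h],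
    (∀ i, G.MemA (M i)) → G.MemA (Module.DirectLimit M f)

/-- `Q`, via `algebraMap R Q`, is the ring of quotients `R_G` of `R` with respect to `G`:
`Q` is `G`-torsion-free and `G`-injective (i.e. `G`-closed) and the kernel and cokernel
of `R → Q` are `G`-torsion. -/
structure IsRingOfQuotients (Q : Type u) [CommRing Q] [Algebra R Q] : Prop where
  torsionFree : ∀ q : Q, Ideal.torsionOf R Q q ∈ G.sets → q = 0
  gInjective : ∀ J ∈ G.sets, ∀ f : ↥J →ₗ[R] Q, ∃ q : Q, ∀ j : ↥J, f j = (j : R) • q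
  ker_torsion : ∀ r : R, algebraMap R Q r = 0 → Ideal.torsionOf R R r ∈ G.sets
  coker_torsion : ∀ q : Q, ∃ J ∈ G.sets, ∀ x ∈ J, ∃ r : R, x • q = algebraMap R Q r

/-- `G` is a perfect Gabriel topology, realised by the perfect localisation `Q`:
`R → Q` is a flat ring epimorphism and `G = {J ∣ JQ = Q}`. -/
def IsPerfectLocalization (Q : Type u) [CommRing Q] [Algebra R Q] : Prop :=
  Module.Flat R Q ∧
  (∀ (S : Type u) [CommRing S] (f g : Q →+* S),
    f.comp (algebraMap R Q) = g.comp (algebraMap R Q) → f = g) ∧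
  (∀ J : Ideal R, J ∈ G.sets ↔ J • (⊤ : Submodule R Q) = ⊤)

end GabrielTopology

/-- A commutative ring is perfect iff every flat module is projective. -/
def IsPerfectRing (S : Type u) [CommRing S] : Prop :=
  ∀ (M : Type u) [AddCommGroup M] [Module S M], Module.Flat S M → Module.Projective S M

/-- `X` is Σ-pure-split: every pure embedding `A ⊆ B` with `B ∈ Add(X)` splits. -/
def SigmaPureSplit (R : Type u) [CommRing R] (X : Type u) [AddCommGroup X] [Module R X] : Prop :=
  ∀ (A B : Type u) [AddCommGroup A] [Module R A] [AddCommGroup B] [Module R B] (i : A →ₗ[R] B),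
    Function.Injective i →
    (∀ (M : Type u) [AddCommGroup M] [Module R M], Function.Injective (LinearMap.rTensor M i)) →
    InAdd R X B → ∃ r : B →ₗ[R] A, r ∘ₗ i = LinearMap.id

/-- A concrete model of `Ext¹_R(M, N)`, computed from the canonical free presentation
`0 → S → (M →₀ R) → M → 0` of `M` as `coker (Hom((M →₀ R), N) → Hom(S, N))`. -/
abbrev ext1 (R : Type u) [CommRing R] (M N : Type u) [AddCommGroup M] [Module R M]
    [AddCommGroup N] [Module R N] : Type u :=
  (↥(LinearMap.ker (Finsupp.linearCombination R (id : M → M))) →ₗ[R] N) ⧸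
    LinearMap.range
      (LinearMap.lcomp R N (LinearMap.ker (Finsupp.linearCombination R (id : M → M))).subtype)

/-- A concrete model of `Tor₁^R(M, N)`, computed from the canonical free presentation
`0 → S → (M →₀ R) → M → 0` of `M` as `ker (S ⊗ N → (M →₀ R) ⊗ N)`. -/
abbrev tor1 (R : Type u) [CommRing R] (M N : Type u) [AddCommGroup M] [Module R M]
    [AddCommGroup N] [Module R N] : Type u :=
  ↥(LinearMap.ker
    (LinearMap.rTensor N (LinearMap.ker (Finsupp.linearCombination R (id : M → M))).subtype))

/-- The cokernel `U/R` of a ring map `R → U`. -/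
abbrev cokerAlg (R U : Type u) [CommRing R] [CommRing U] [Algebra R U] : Type u :=
  U ⧸ LinearMap.range (Algebra.linearMap R U)

/-- A linear topology on a commutative ring `R`, given by its filter of open ideals. -/
structure LinearTopologyOn (R : Type u) [CommRing R] : Type u where
  sets : Set (Ideal R)
  top_mem : (⊤ : Ideal R) ∈ sets
  mem_of_le : ∀ {I J : Ideal R}, I ∈ sets → I ≤ J → J ∈ sets
  inf_mem : ∀ {I J : Ideal R}, I ∈ sets → J ∈ sets → I ⊓ J ∈ sets

/-- An `R`-module `M` is `H`-discrete if the annihilator of every element is open. -/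
def LinearTopologyOn.IsDiscrete {R : Type u} [CommRing R] (H : LinearTopologyOn R)
    (M : Type u) [AddCommGroup M] [Module R M] : Prop :=
  ∀ x : M, Ideal.torsionOf R M x ∈ H.sets

/-- `R` is `H`-h-local: every open ideal is contained in only finitely many maximal ideals,
and every open prime ideal is contained in only one maximal ideal. -/
def LinearTopologyOn.IsHLocal {R : Type u} [CommRing R] (H : LinearTopologyOn R) : Prop :=
  (∀ J ∈ H.sets, {m : Ideal R | m.IsMaximal ∧ J ≤ m}.Finite) ∧
  (∀ p ∈ H.sets, p.IsPrime →
    ∀ m n : Ideal R, m.IsMaximal → n.IsMaximal → p ≤ m → p ≤ n → m = n)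

/-- Over `S`, `M` admits a resolution of length `n` by finitely generated projectives. -/
def FGProjDimLE (S : Type u) [CommRing S] :
    ℕ → ∀ (M : Type u) [AddCommGroup M] [Module S M], Prop
  | 0, M, iA, iM =>
      letI := iA; letI := iM
      Module.Finite S M ∧ Module.Projective S M
  | n + 1, M, iA, iM =>
      letI := iA; letI := iM
      ∃ (k : ℕ) (f : (Fin k → S) →ₗ[S] M),
        Function.Surjective f ∧ FGProjDimLE S n ↥(LinearMap.ker f)

open TensorProduct

section Contramodule

variable {R : Type u} [CommRing R]

theorem LinearMap.exists_comp_eq_of_ker_le {A B C : Type*} [AddCommGroup A] [Module R A]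
    [AddCommGroup B] [Module R B] [AddCommGroup C] [Module R C] {p : A →ₗ[R] B}
    (hp : Function.Surjective p) (g : A →ₗ[R] C) (h : LinearMap.ker p ≤ LinearMap.ker g) :
    ∃ s : B →ₗ[R] C, ∀ a, s (p a) = g a := by
  refine ⟨(LinearMap.ker p).liftQ g h ∘ₗ (p.quotKerEquivOfSurjective hp).symm.toLinearMap,
    fun a ↦ ?_⟩
  have : (p.quotKerEquivOfSurjective hp).symm (p a) = Submodule.Quotient.mk a := by
    rw [LinearEquiv.symm_apply_eq]
    rfl
  simp [this]

theorem LinearMap.exists_comp_eq_of_range_le {A B C : Type*} [AddCommMonoid A] [Module R A]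
    [AddCommGroup B] [Module R B] [AddCommGroup C] [Module R C] {i : B →ₗ[R] C}
    (hi : Function.Injective i) (g : A →ₗ[R] C) (h : ∀ a, g a ∈ LinearMap.range i) :
    ∃ s : A →ₗ[R] B, ∀ a, i (s a) = g a := by
  refine ⟨(LinearEquiv.ofInjective i hi).symm.toLinearMap ∘ₗ g.codRestrict _ h, fun a ↦ ?_⟩
  simp

/-- A retraction of every extension of `M` by `N` yields the vanishing of `Ext¹`. -/
theorem Ext1Vanish.of_retraction {M N : Type u} [AddCommGroup M] [Module R M]
    [AddCommGroup N] [Module R N]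
    (H : ∀ (E : Type u) [AddCommGroup E] [Module R E] (i : N →ₗ[R] E) (p : E →ₗ[R] M),
      Function.Injective i → Function.Surjective p → LinearMap.range i = LinearMap.ker p →
        ∃ r : E →ₗ[R] N, ∀ n, r (i n) = n) : Ext1Vanish R M N := by
  intro E _ _ i p hi hp hip
  obtain ⟨r, hr⟩ := H E i p hi hp hip
  obtain ⟨s, hs⟩ := LinearMap.exists_comp_eq_of_ker_le hp (LinearMap.id - i ∘ₗ r) (by
    intro e he
    rw [← hip] at he
    obtain ⟨n, rfl⟩ := he
    simp [hr])
  refine ⟨s, LinearMap.ext fun m ↦ ?_⟩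
  obtain ⟨e, rfl⟩ := hp m
  have : p (i (r e)) = 0 := by
    rw [← LinearMap.mem_ker, ← hip]
    exact ⟨_, rfl⟩
  simp [hs, this]

/-- If `Ext¹(M, A) = 0`, maps from `M` lift along epimorphisms with kernel `A`. -/
theorem Ext1Vanish.exists_lift {M A B D : Type u} [AddCommGroup M] [Module R M]
    [AddCommGroup A] [Module R A] [AddCommGroup B] [Module R B] [AddCommGroup D] [Module R D]
    (H : Ext1Vanish R M A) {j : A →ₗ[R] B} {π : B →ₗ[R] D} (hj : Function.Injective j)
    (hπ : Function.Surjective π) (hjπ : LinearMap.range j = LinearMap.ker π)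
    (f : M →ₗ[R] D) : ∃ g : M →ₗ[R] B, ∀ m, π (g m) = f m := by
  let Y : Submodule R (M × B) :=
    LinearMap.ker (f ∘ₗ LinearMap.fst R M B - π ∘ₗ LinearMap.snd R M B)
  have hY : ∀ y : M × B, y ∈ Y ↔ f y.1 = π y.2 := fun y ↦ by simp [Y, sub_eq_zero]
  have hj0 : ∀ a, π (j a) = 0 := fun a ↦ by
    rw [← LinearMap.mem_ker, ← hjπ]
    exact ⟨a, rfl⟩
  let i : A →ₗ[R] Y := (LinearMap.inr R M B ∘ₗ j).codRestrict Y fun a ↦ by simp [hY, hj0]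
  let p : Y →ₗ[R] M := LinearMap.fst R M B ∘ₗ Y.subtype
  obtain ⟨s, hs⟩ := H Y i p
    (fun a b h ↦ hj (congrArg (fun y : Y ↦ y.1.2) h))
    (fun m ↦ by
      obtain ⟨b, hb⟩ := hπ (f m)
      exact ⟨⟨(m, b), (hY _).2 hb.symm⟩, rfl⟩)
    (by
      ext ⟨⟨m, b⟩, h⟩
      rw [hY] at h
      constructor
      · rintro ⟨a, ha⟩
        exact (congrArg (fun y : Y ↦ y.1.1) ha).symm
      · intro (hm : m = 0)
        subst hm
        have hb : b ∈ LinearMap.range j := by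
          rw [hjπ, LinearMap.mem_ker]
          simpa using h.symm
        obtain ⟨a, rfl⟩ := hb
        exact ⟨a, rfl⟩)
  refine ⟨LinearMap.snd R M B ∘ₗ Y.subtype ∘ₗ s, fun m ↦ ?_⟩
  have h1 : (s m).1.1 = m := LinearMap.congr_fun hs m
  have h2 := (hY _).1 (s m).2
  rw [h1] at h2
  exact h2.symm

/-- `Hom(K, I)` is cotorsion against flat modules when `I` is injective. -/
theorem Ext1Vanish.of_flat_of_injective (Z K I : Type u) [AddCommGroup Z] [Module R Z]
    [AddCommGroup K] [Module R K] [AddCommGroup I] [Module R I]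
    [Module.Flat R Z] [Module.Injective R I] : Ext1Vanish R Z (K →ₗ[R] I) := by
  refine Ext1Vanish.of_retraction fun E _ _ i p hi hp hip ↦ ?_
  have hinj := LinearMap.lTensor_injective_of_exact_of_flat p hp i hi
    (LinearMap.exact_iff.2 hip.symm) K
  obtain ⟨h, hh⟩ := Module.Injective.extension_property R I _ _ (i.lTensor K) hinj
    (TensorProduct.lift (LinearMap.id (R := R) (M := K →ₗ[R] I)).flip)
  refine ⟨(TensorProduct.curry h).flip, fun n ↦ LinearMap.ext fun k ↦ ?_⟩
  simpa using LinearMap.congr_fun hh (k ⊗ₜ n)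

/-- If `U` is flat and `K ⊗ U = 0`, maps to `Hom(K, M)` extend along monomorphisms with
cokernel `U`. -/
theorem exists_extension_of_subsingleton_tensor {K U X Y M : Type u} [AddCommGroup K] [Module R K]
    [AddCommGroup U] [Module R U] [AddCommGroup X] [Module R X] [AddCommGroup Y] [Module R Y]
    [AddCommGroup M] [Module R M] [Module.Flat R U] [Subsingleton (K ⊗[R] U)]
    {i : X →ₗ[R] Y} {p : Y →ₗ[R] U} (hi : Function.Injective i) (hp : Function.Surjective p)
    (hip : LinearMap.range i = LinearMap.ker p) (f : X →ₗ[R] K →ₗ[R] M) :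
    ∃ g : Y →ₗ[R] K →ₗ[R] M, ∀ x, g (i x) = f x := by
  have hex : Function.Exact i p := LinearMap.exact_iff.2 hip.symm
  have hinj := LinearMap.lTensor_injective_of_exact_of_flat p hp i hi hex K
  have hsurj : Function.Surjective (i.lTensor K) := fun y ↦
    (lTensor_exact K hex hp y).1 (Subsingleton.elim _ _)
  let e := LinearEquiv.ofBijective (i.lTensor K) ⟨hinj, hsurj⟩
  refine ⟨(TensorProduct.curry (TensorProduct.lift f.flip ∘ₗ e.symm.toLinearMap)).flip,
    fun x ↦ LinearMap.ext fun k ↦ ?_⟩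
  have : e.symm (k ⊗ₜ i x) = k ⊗ₜ x := by
    rw [LinearEquiv.symm_apply_eq]
    rfl
  simp [this]

theorem hom_hom_eq_zero_of_subsingleton_tensor {K U M : Type*} [AddCommGroup K] [Module R K]
    [AddCommGroup U] [Module R U] [AddCommGroup M] [Module R M] [Subsingleton (K ⊗[R] U)]
    (f : U →ₗ[R] K →ₗ[R] M) : f = 0 := by
  ext x k
  have : k ⊗ₜ[R] x = 0 := Subsingleton.elim _ _
  simpa using congrArg (TensorProduct.lift f.flip) this

theorem Ext1Vanish.hom_of_subsingleton_tensor (K U M : Type u) [AddCommGroup K] [Module R K]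
    [AddCommGroup U] [Module R U] [AddCommGroup M] [Module R M] [Module.Flat R U]
    [Subsingleton (K ⊗[R] U)] : Ext1Vanish R U (K →ₗ[R] M) :=
  Ext1Vanish.of_retraction fun _ _ _ _ _ hi hp hip ↦
    exists_extension_of_subsingleton_tensor hi hp hip LinearMap.id

/-- The kernel of an epimorphism between flat modules is flat. -/
theorem Module.Flat.ker_of_surjective {P U : Type u} [AddCommGroup P] [Module R P]
    [AddCommGroup U] [Module R U] [Module.Flat R P] [Module.Flat R U] (q : P →ₗ[R] U)
    (hq : Function.Surjective q) : Module.Flat R (LinearMap.ker q) := by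
  rw [Module.Flat.iff_rTensor_preserves_injective_linearMap]
  intro A B _ _ _ _ f hf
  have h1 := LinearMap.lTensor_injective_of_exact_of_flat q hq _
    (LinearMap.ker q).subtype_injective (LinearMap.exact_subtype_ker_map q) A
  have h2 := (Module.Flat.rTensor_preserves_injective_linearMap (M := P) f hf).comp h1
  have h3 : LinearMap.rTensor P f ∘ₗ LinearMap.lTensor A (LinearMap.ker q).subtype =
      LinearMap.lTensor B (LinearMap.ker q).subtype ∘ₗ LinearMap.rTensor _ f := by
    rw [LinearMap.rTensor_comp_lTensor, LinearMap.lTensor_comp_rTensor]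
  rw [← LinearMap.coe_comp, h3, LinearMap.coe_comp] at h2
  exact h2.of_comp

/-- A cokernel of a monomorphism `Hom(K, I) → Hom(K, Q)` with `I` injective is a contramodule
with respect to a flat module `U` such that `K ⊗ U = 0`. -/
theorem contramodule_of_presentation {K U I Q D : Type u} [AddCommGroup K] [Module R K]
    [AddCommGroup U] [Module R U] [AddCommGroup I] [Module R I] [AddCommGroup Q] [Module R Q]
    [AddCommGroup D] [Module R D] [Module.Flat R U] [Module.Injective R I]
    [Subsingleton (K ⊗[R] U)] {j : (K →ₗ[R] I) →ₗ[R] (K →ₗ[R] Q)} {π : (K →ₗ[R] Q) →ₗ[R] D}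
    (hj : Function.Injective j) (hπ : Function.Surjective π)
    (hjπ : LinearMap.range j = LinearMap.ker π) :
    (∀ f : U →ₗ[R] D, f = 0) ∧ Ext1Vanish R U D := by
  constructor
  · intro f
    obtain ⟨g, hg⟩ := (Ext1Vanish.of_flat_of_injective U K I).exists_lift hj hπ hjπ f
    ext x
    rw [← hg, hom_hom_eq_zero_of_subsingleton_tensor g]
    simp
  · intro E _ _ i p hi hp hip
    have hpi : ∀ d, p (i d) = 0 := fun d ↦ by
      rw [← LinearMap.mem_ker, ← hip]
      exact ⟨d, rfl⟩
    let q : (U →₀ R) →ₗ[R] U := Finsupp.linearCombination R id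
    have hq : Function.Surjective q :=
      Finsupp.linearCombination_surjective R Function.surjective_id
    obtain ⟨t, ht⟩ := Module.projective_lifting_property p q hp
    have ht' : ∀ x, p (t x) = q x := LinearMap.congr_fun ht
    have := Module.Flat.ker_of_surjective q hq
    obtain ⟨z, hz⟩ := LinearMap.exists_comp_eq_of_range_le hi (t ∘ₗ (LinearMap.ker q).subtype)
      (by
        intro x
        rw [hip, LinearMap.mem_ker]
        simp [ht'])
    obtain ⟨w, hw⟩ :=
      (Ext1Vanish.of_flat_of_injective (LinearMap.ker q) K I).exists_lift hj hπ hjπ z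
    obtain ⟨W, hW⟩ := exists_extension_of_subsingleton_tensor (K := K)
      (LinearMap.ker q).subtype_injective hq (Submodule.range_subtype _) w
    obtain ⟨s, hs⟩ := LinearMap.exists_comp_eq_of_ker_le hq (t - i ∘ₗ π ∘ₗ W) (by
      intro x hx
      have h1 : W x = w ⟨x, hx⟩ := hW ⟨x, hx⟩
      have h2 : i (z ⟨x, hx⟩) = t x := hz ⟨x, hx⟩
      simp [h1, hw, h2])
    refine ⟨s, LinearMap.ext fun u ↦ ?_⟩
    obtain ⟨x, rfl⟩ := hq u
    simp [hs, hpi, ht']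

/-- For an embedding `ι` of `N` into an injective module `I`, the connecting map presents
`Ext¹(K, N)` as the cokernel of `Hom(K, I) → Hom(K, I/N)`. -/
theorem exists_ext1_presentation (K N I : Type u) [AddCommGroup K] [Module R K]
    [AddCommGroup N] [Module R N] [AddCommGroup I] [Module R I] [Module.Injective R I]
    (ι : N →ₗ[R] I) (hι : Function.Injective ι) :
    ∃ π : (K →ₗ[R] I ⧸ LinearMap.range ι) →ₗ[R] ext1 R K N, Function.Surjective π ∧
      LinearMap.range ((LinearMap.range ι).mkQ.compRight R : (K →ₗ[R] I) →ₗ[R] _) =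
        LinearMap.ker π := by
  let p := (LinearMap.range ι).mkQ
  let q : (K →₀ R) →ₗ[R] K := Finsupp.linearCombination R id
  have hq : Function.Surjective q :=
    Finsupp.linearCombination_surjective R Function.surjective_id
  let V := LinearMap.range (LinearMap.lcomp R N (LinearMap.ker q).subtype)
  have hpι : ∀ n, p (ι n) = 0 := fun n ↦ by simp [p]
  let Rel : (K →ₗ[R] I ⧸ LinearMap.range ι) → (LinearMap.ker q →ₗ[R] N) → Prop := fun f s ↦
    ∃ g : (K →₀ R) →ₗ[R] I, (∀ x, p (g x) = f (q x)) ∧ ∀ x : LinearMap.ker q, ι (s x) = g x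
  have hex : ∀ f, ∃ s, Rel f s := fun f ↦ by
    obtain ⟨g, hg⟩ := Module.projective_lifting_property p (f ∘ₗ q) (Submodule.mkQ_surjective _)
    have hg' : ∀ x, p (g x) = f (q x) := LinearMap.congr_fun hg
    obtain ⟨s, hs⟩ := LinearMap.exists_comp_eq_of_range_le hι (g ∘ₗ (LinearMap.ker q).subtype)
      (by
        intro x
        rw [← Submodule.Quotient.mk_eq_zero]
        refine (hg' _).trans ?_
        simp)
    exact ⟨s, g, hg', hs⟩
  have hzero : ∀ f s, Rel f s → ((∃ k, p ∘ₗ k = f) ↔ s ∈ V) := by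
    rintro f s ⟨g, hg, hs⟩
    constructor
    · rintro ⟨k, rfl⟩
      obtain ⟨h, hh⟩ := LinearMap.exists_comp_eq_of_range_le hι (g - k ∘ₗ q) (by
        intro x
        rw [← Submodule.Quotient.mk_eq_zero]
        change p ((g - k ∘ₗ q) x) = 0
        simp [hg])
      refine ⟨h, LinearMap.ext fun x ↦ hι ?_⟩
      simp [hh, hs]
    · rintro ⟨h, rfl⟩
      obtain ⟨k, hk⟩ := LinearMap.exists_comp_eq_of_ker_le hq (g - ι ∘ₗ h) (by
        intro x hx
        have := hs ⟨x, hx⟩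
        simp only [LinearMap.lcomp_apply, Submodule.subtype_apply] at this
        simp [this])
      refine ⟨k, LinearMap.ext fun y ↦ ?_⟩
      obtain ⟨x, rfl⟩ := hq y
      simp [hk, hg, hpι]
  have hadd : ∀ f s f' s', Rel f s → Rel f' s' → Rel (f + f') (s + s') := by
    rintro f s f' s' ⟨g, hg, hs⟩ ⟨g', hg', hs'⟩
    exact ⟨g + g', fun x ↦ by simp [hg, hg'], fun x ↦ by simp [hs, hs']⟩
  have hsmul : ∀ (r : R) f s, Rel f s → Rel (r • f) (r • s) := by
    rintro r f s ⟨g, hg, hs⟩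
    exact ⟨r • g, fun x ↦ by simp [hg], fun x ↦ by simp [hs]⟩
  have huniq : ∀ f s s', Rel f s → Rel f s' →
      (Submodule.Quotient.mk s : ext1 R K N) = Submodule.Quotient.mk s' := by
    intro f s s' h h'
    have := hadd _ _ _ _ h (hsmul (-1) _ _ h')
    refine (Submodule.Quotient.eq V).2 ?_
    have h0 := (hzero _ _ this).1 ⟨0, by rw [LinearMap.comp_zero]; module⟩
    simpa [sub_eq_add_neg] using h0
  choose σ hσ using hex
  let π : (K →ₗ[R] I ⧸ LinearMap.range ι) →ₗ[R] ext1 R K N :=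
    { toFun := fun f ↦ Submodule.Quotient.mk (σ f)
      map_add' := fun f f' ↦ huniq _ _ _ (hσ _) (hadd _ _ _ _ (hσ f) (hσ f'))
      map_smul' := fun r f ↦ huniq _ _ _ (hσ _) (hsmul r _ _ (hσ f)) }
  refine ⟨π, fun y ↦ ?_, ?_⟩
  · obtain ⟨s, rfl⟩ := Submodule.Quotient.mk_surjective _ y
    obtain ⟨g, hg⟩ := Module.Injective.extension_property R I (LinearMap.ker q) _ (LinearMap.ker q).subtype
      (LinearMap.ker q).subtype_injective (ι ∘ₗ s)
    have hg' : ∀ x : LinearMap.ker q, g x = ι (s x) := LinearMap.congr_fun hg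
    obtain ⟨f, hf⟩ := LinearMap.exists_comp_eq_of_ker_le hq (p ∘ₗ g) (by
      intro x hx
      have := hg' ⟨x, hx⟩
      simp only at this
      simp [this, hpι])
    exact ⟨f, huniq f _ _ (hσ f) ⟨g, fun x ↦ (hf x).symm, fun x ↦ (hg' x).symm⟩⟩
  · ext f
    rw [LinearMap.mem_ker]
    exact (hzero f _ (hσ f)).trans (Submodule.Quotient.mk_eq_zero V).symm

theorem Module.exists_injective_embedding (N : Type u) [AddCommGroup N] [Module R N] :
    ∃ (I : ModuleCat.{u} R) (ι : N →ₗ[R] I), Module.Injective R I ∧ Function.Injective ι := by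
  obtain ⟨P⟩ := CategoryTheory.EnoughInjectives.presentation (ModuleCat.of R N)
  have : CategoryTheory.Injective (ModuleCat.of R P.J) := P.injective
  exact ⟨P.J, P.f.hom, Module.injective_module_of_injective_object R P.J,
    (ModuleCat.mono_iff_injective P.f).1 P.mono⟩

theorem subsingleton_cokerAlg_tensor (U : Type u) [CommRing U] [Algebra R U]
    [Algebra.IsEpi R U] : Subsingleton (cokerAlg R U ⊗[R] U) := by
  refine subsingleton_of_forall_eq 0 fun x ↦ ?_
  induction x with
  | zero => rfl
  | add x y hx hy => rw [hx, hy, add_zero]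
  | tmul k u =>
    obtain ⟨v, rfl⟩ := Submodule.Quotient.mk_surjective _ k
    have h : v ⊗ₜ[R] u = 1 ⊗ₜ[R] (v * u) := by
      have h1 := (Algebra.isEpi_iff_forall_one_tmul_eq R U).1 inferInstance v
      simpa using congrArg (fun t ↦ t * ((1 : U) ⊗ₜ[R] u)) h1.symm
    have h1 : (Submodule.Quotient.mk 1 : cokerAlg R U) = 0 := by
      rw [Submodule.Quotient.mk_eq_zero]
      exact ⟨1, by simp⟩
    have h2 := congrArg
      (LinearMap.rTensor U (LinearMap.range (Algebra.linearMap R U)).mkQ) h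
    simpa [h1] using h2

/-- If `U` is flat and `K ⊗ U = 0`, the annihilator `J` of any element of `K` satisfies
`J U = U`. -/
theorem torsionOf_smul_top_eq_top {K U : Type u} [AddCommGroup K] [Module R K]
    [AddCommGroup U] [Module R U] [Module.Flat R U] [Subsingleton (K ⊗[R] U)] (k : K) :
    Ideal.torsionOf R K k • (⊤ : Submodule R U) = ⊤ := by
  rw [eq_top_iff]
  intro u _
  have hex := Module.Flat.rTensor_exact U
    (LinearMap.exact_subtype_ker_map (LinearMap.toSpanSingleton R K k))
  obtain ⟨y, hy⟩ := (hex (1 ⊗ₜ u)).1 (Subsingleton.elim _ _)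
  have key : ∀ y, TensorProduct.lid R U (LinearMap.rTensor U
      (LinearMap.ker (LinearMap.toSpanSingleton R K k)).subtype y) ∈
        Ideal.torsionOf R K k • (⊤ : Submodule R U) := by
    intro y
    induction y with
    | zero => simp
    | add x y hx hy =>
      rw [map_add, map_add]
      exact add_mem hx hy
    | tmul r v =>
      simpa using Submodule.smul_mem_smul (show r.1 ∈ Ideal.torsionOf R K k from r.2)
        (Submodule.mem_top (x := v))
  simpa [hy] using key y

end Contramodule

theorem stmt12 (R : Type u) [CommRing R] (G : GabrielTopology R)
    (U : Type u) [CommRing U] [Algebra R U]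
    (hinj : Function.Injective (algebraMap R U))
    (hflat : Module.Flat R U)
    (hepi : ∀ (S : Type u) [CommRing S] (f g : U →+* S),
      f.comp (algebraMap R U) = g.comp (algebraMap R U) → f = g)
    (hGchar : ∀ J : Ideal R, J ∈ G.sets ↔ J • (⊤ : Submodule R U) = ⊤) :
    (∀ (M : Type u) [AddCommGroup M] [Module R M],
      (∀ f : U →ₗ[R] (cokerAlg R U →ₗ[R] M), f = 0) ∧
      Ext1Vanish R U (cokerAlg R U →ₗ[R] M)) ∧
    (∀ (N : Type u) [AddCommGroup N] [Module R N], G.IsTorsionFree N →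
      (∀ f : U →ₗ[R] ext1 R (cokerAlg R U) N, f = 0) ∧
      Ext1Vanish R U (ext1 R (cokerAlg R U) N)) := by
  have hE : Algebra.IsEpi R U := CommRingCat.epi_iff_epi.1 ⟨fun {S} f g h ↦
    CommRingCat.hom_ext (hepi S f.hom g.hom (congrArg CommRingCat.Hom.hom h))⟩
  have hsub := subsingleton_cokerAlg_tensor (R := R) U
  refine ⟨fun M _ _ ↦ ⟨hom_hom_eq_zero_of_subsingleton_tensor,
    Ext1Vanish.hom_of_subsingleton_tensor _ U M⟩, fun N _ _ hN ↦ ?_⟩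
  have hKN : ∀ f : cokerAlg R U →ₗ[R] N, f = 0 := by
    intro f
    refine LinearMap.ext fun k ↦ hN _ (G.mem_of_le ((hGchar _).2
      (torsionOf_smul_top_eq_top (U := U) k)) fun r hr ↦ ?_)
    rw [Ideal.mem_torsionOf_iff] at hr ⊢
    rw [← map_smul, hr, map_zero]
  obtain ⟨I, ι, hI, hι⟩ := Module.exists_injective_embedding (R := R) N
  obtain ⟨π, hπ, hjπ⟩ := exists_ext1_presentation (cokerAlg R U) N I ι hι
  refine contramodule_of_presentation ?_ hπ hjπ
  rw [injective_iff_map_eq_zero]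
  intro k hk
  obtain ⟨h, hh⟩ := LinearMap.exists_comp_eq_of_range_le hι k (fun x ↦ by
    rw [← Submodule.Quotient.mk_eq_zero]
    exact LinearMap.congr_fun hk x)
  ext x
  simp [← hh, hKN h]
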